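/- arXiv:cond-mat/0210654 — 2 statements merged into one kernel-verified Lean document; each statement's English description precedes it below -/
import Mathlib

section
/- The Algorithmic Information Content is not computable: there is no total computable function from A* to ℕ that agrees with AIC on every finite string (Chaitin's theorem). -/
open Filter MeasureTheory
open scoped ENNReal

/-- The bit-length ⌈log₂(p+1)⌉ of a program `p : ℕ`. -/
def bitLen (p : ℕ) : ℕ := Nat.clog 2 (p + 1)

/-- Algorithmic Information Content of a finite string, with respect to a fixed bijection
`e` between strings and naturals: the minimal bit-length of a program `p` (a natural number,
interpreted as the `p`-th partial recursive function in Mathlib's standard enumeration of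
`Nat.Partrec.Code`) which halts on input `0` with output the code of `s`. -/
noncomputable def AIC {A : Type*} (e : List A ≃ ℕ) (s : List A) : ℕ :=
  sInf {m | ∃ p : ℕ, e s ∈ (Denumerable.ofNat Nat.Partrec.Code p).eval 0 ∧ m = bitLen p}

open Nat.Partrec (Code)

theorem bitLen_le_self (p : ℕ) : bitLen p ≤ p :=
  Nat.clog_le_of_le_pow Nat.lt_two_pow_self

/-- Every string is the output of a program whose bit-length is its information content. -/
theorem exists_eval_and_AIC_eq {A : Type*} (e : List A ≃ ℕ) (s : List A) :
    ∃ p : ℕ, e s ∈ (Denumerable.ofNat Code p).eval 0 ∧ AIC e s = bitLen p := by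
  refine Nat.sInf_mem (s := {m | ∃ p : ℕ, e s ∈ (Denumerable.ofNat Code p).eval 0 ∧
    m = bitLen p}) ⟨_, Encodable.encode (Code.const (e s)), ?_, rfl⟩
  simp [Code.eval_const]

theorem AIC_le_bitLen {A : Type*} (e : List A ≃ ℕ) {s : List A} {p : ℕ}
    (h : e s ∈ (Denumerable.ofNat Code p).eval 0) : AIC e s ≤ bitLen p :=
  Nat.sInf_le ⟨p, h, rfl⟩

/-- Information content is unbounded: there are only finitely many programs of a given length. -/
theorem exists_lt_AIC {A : Type*} (e : List A ≃ ℕ) (K : ℕ) : ∃ s, K < AIC e s := by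
  by_contra! hK
  choose p hp hlen using exists_eval_and_AIC_eq e
  have hlt (s : List A) : p s < 2 ^ K := by
    have h := (Nat.clog_le_iff_le_pow one_lt_two).1 ((hlen s).symm.trans_le (hK s))
    omega
  have hinj : Function.Injective fun s => (⟨p s, hlt s⟩ : Fin (2 ^ K)) := by
    intro s t hst
    have hst : p s = p t := congrArg Fin.val hst
    exact e.injective (Part.mem_unique (hp s) (hst ▸ hp t))
  have : Infinite (List A) := e.infinite_iff.2 inferInstance
  exact not_injective_infinite_finite _ hinj

/-- **Chaitin's theorem.** The Algorithmic Information Content is not computable: there is no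
total computable function from `A*` to `ℕ` agreeing with `AIC` on every finite string. -/
theorem stmt_0 {A : Type} [Primcodable A] [Fintype A] [Nonempty A]
    (e : List A ≃ ℕ) (he : Computable fun s : List A => e s)
    (he' : Computable fun n : ℕ => e.symm n) :
    ¬ ∃ f : List A → ℕ, Computable f ∧ ∀ s : List A, f s = AIC e s := by
  rintro ⟨f, hf, hfe⟩
  let g : Code → ℕ →. ℕ := fun c _ =>
    Nat.rfind fun n => Part.some (decide (Encodable.encode c < f (e.symm n)))
  have hg : Partrec₂ g := by
    have hd : Computable fun q : (Code × ℕ) × ℕ =>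
        decide (Encodable.encode q.1.1 < f (e.symm q.2)) :=
      (Primrec.nat_lt.decide.to_comp).comp
        (Computable.encode.comp (Computable.fst.comp Computable.fst))
        (hf.comp (he'.comp Computable.snd))
    exact Partrec.rfind hd.partrec.to₂
  obtain ⟨c, hc⟩ := Code.fixed_point₂ hg
  obtain ⟨s, hs⟩ := exists_lt_AIC e (Encodable.encode c)
  have hdom : (g c 0).Dom :=
    Nat.rfind_dom.2 ⟨e s, by simpa [hfe] using hs, fun _ => trivial⟩
  obtain ⟨n, hn⟩ := Part.dom_iff_mem.1 hdom
  have hlt : Encodable.encode c < AIC e (e.symm n) := by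
    simpa [hfe] using Nat.rfind_spec hn
  have hle : AIC e (e.symm n) ≤ bitLen (Encodable.encode c) :=
    AIC_le_bitLen e (by simpa [hc] using hn)
  exact (hle.trans (bitLen_le_self _)).not_gt hlt
end

section
/- If μ is an ergodic shift-invariant Borel probability measure on A^ℕ, then for μ-almost every ω ∈ A^ℕ the limit Ĥ(ω) = lim_{l→∞} limsup_{n→∞} Ĥ_l(ω^n) exists and equals h(μ), the entropy of the shift with respect to μ. -/
open Filter MeasureTheory
open scoped ENNReal

/-- The string of the first `n` symbols of an infinite sequence. -/
def pref {A : Type*} (ω : ℕ → A) (n : ℕ) : List A := (List.range n).map ω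

/-- The finite set of `l`-blocks occurring in the string `s`. -/
def blocks {A : Type*} [DecidableEq A] (l : ℕ) (s : List A) : Finset (List A) :=
  (Finset.range (s.length - l + 1)).image fun i => (s.drop i).take l

/-- Empirical frequency `P(s,w)`: number of occurrences of `w` as a block of consecutive
symbols of `s`, divided by `|s| - |w| + 1`. -/
noncomputable def empFreq {A : Type*} [DecidableEq A] (s : List A) (w : List A) : ℝ :=
  (((Finset.range (s.length - w.length + 1)).filter
      fun i => (s.drop i).take w.length = w).card : ℝ) / ((s.length - w.length + 1 : ℕ) : ℝ)

/-- The `l`-th empirical entropy `Ĥ_l(s) = -(1/l) Σ_w P(s,w) log₂ P(s,w)`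
(words `w` with `P(s,w) = 0` contribute `0`, so it suffices to sum over occurring blocks). -/
noncomputable def empEnt {A : Type*} [DecidableEq A] (l : ℕ) (s : List A) : ℝ :=
  -(1 / (l : ℝ)) * ∑ w ∈ blocks l s, empFreq s w * Real.logb 2 (empFreq s w)

/-- The shift map on one-sided infinite sequences. -/
def shift {A : Type*} (ω : ℕ → A) : ℕ → A := fun i => ω (i + 1)

/-- The cylinder over a word `w` of length `n`. -/
def cyl {A : Type*} {n : ℕ} (w : Fin n → A) : Set (ℕ → A) := {ω | ∀ i : Fin n, ω (i : ℕ) = w i}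

/-- The sequence whose limit is the (Shannon/Kolmogorov-Sinai) entropy `h(μ)` of the shift:
`(1/n) Σ_{w ∈ A^n} -μ(C(w)) log₂ μ(C(w))`. -/
noncomputable def entSeq {A : Type*} [Fintype A] [MeasurableSpace A]
    (μ : Measure (ℕ → A)) (n : ℕ) : ℝ :=
  (1 / (n : ℝ)) * ∑ w : Fin n → A,
    -((μ (cyl w)).toReal * Real.logb 2 ((μ (cyl w)).toReal))

/-- The maximum of the Birkhoff sums of `g` of length at most `n` (including the empty sum `0`),
defined by its recursion along the orbit. -/
noncomputable def birkhoffMax {α : Type*} (T : α → α) (g : α → ℝ) : ℕ → α → ℝ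
  | 0 => fun _ => 0
  | n + 1 => fun x => max 0 (g x + birkhoffMax T g n (T x))

section BirkhoffMax

variable {α : Type*} {T : α → α} {g : α → ℝ}

theorem birkhoffMax_nonneg (n : ℕ) (x : α) : 0 ≤ birkhoffMax T g n x := by
  cases n with
  | zero => exact le_rfl
  | succ n => exact le_max_left _ _

theorem birkhoffMax_le_succ (n : ℕ) (x : α) :
    birkhoffMax T g n x ≤ birkhoffMax T g (n + 1) x := by
  induction n generalizing x with
  | zero => exact birkhoffMax_nonneg 1 x
  | succ n ih => exact max_le_max le_rfl (add_le_add le_rfl (ih (T x)))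

theorem monotone_birkhoffMax (x : α) : Monotone fun n => birkhoffMax T g n x :=
  monotone_nat_of_le_succ fun n => birkhoffMax_le_succ n x

theorem birkhoffSum_le_birkhoffMax (n : ℕ) (x : α) :
    birkhoffSum T g n x ≤ birkhoffMax T g n x := by
  induction n generalizing x with
  | zero => simp [birkhoffMax]
  | succ n ih =>
    rw [birkhoffSum_succ']
    exact (add_le_add le_rfl (ih (T x))).trans (le_max_right _ _)

theorem birkhoffMax_le_add_of_pos {n : ℕ} {x : α} (h : 0 < birkhoffMax T g n x) :
    birkhoffMax T g n x ≤ g x + birkhoffMax T g n (T x) := by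
  cases n with
  | zero => exact absurd h (lt_irrefl 0)
  | succ n =>
    refine max_le ?_ (add_le_add le_rfl (birkhoffMax_le_succ n (T x)))
    have h' : 0 < g x + birkhoffMax T g n (T x) := by
      simpa [birkhoffMax] using h
    exact h'.le.trans (add_le_add le_rfl (birkhoffMax_le_succ n (T x)))

variable [MeasurableSpace α] {μ : Measure α}

theorem measurable_birkhoffMax (hT : Measurable T) (hg : Measurable g) (n : ℕ) :
    Measurable (birkhoffMax T g n) := by
  induction n with
  | zero => exact measurable_const
  | succ n ih => exact measurable_const.max (hg.add (ih.comp hT))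

theorem integrable_birkhoffMax (hT : MeasurePreserving T μ μ) (hg : Integrable g μ) (n : ℕ) :
    Integrable (birkhoffMax T g n) μ := by
  induction n with
  | zero => exact integrable_zero _ _ _
  | succ n ih =>
    exact (integrable_zero _ _ _).sup (hg.add (hT.integrable_comp_of_integrable ih))

/-- The maximal ergodic theorem. -/
theorem setIntegral_birkhoffMax_pos_nonneg (hT : MeasurePreserving T μ μ) (hgm : Measurable g)
    (hg : Integrable g μ) (n : ℕ) :
    0 ≤ ∫ x in {x | 0 < birkhoffMax T g n x}, g x ∂μ := by
  have hM := integrable_birkhoffMax hT hg n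
  have hMT : Integrable (fun x => birkhoffMax T g n (T x)) μ :=
    hT.integrable_comp_of_integrable hM
  have hs : MeasurableSet {x | 0 < birkhoffMax T g n x} :=
    measurableSet_lt measurable_const (measurable_birkhoffMax hT.measurable hgm n)
  have hcomp : ∫ x, birkhoffMax T g n (T x) ∂μ = ∫ x, birkhoffMax T g n x ∂μ := by
    have hm := (measurable_birkhoffMax hT.measurable hgm n).aestronglyMeasurable (μ := μ.map T)
    rw [← integral_map hT.measurable.aemeasurable hm, hT.map_eq]
  rw [← integral_indicator hs]
  calc (0 : ℝ) = ∫ x, (birkhoffMax T g n x - birkhoffMax T g n (T x)) ∂μ := by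
        rw [integral_sub hM hMT, hcomp, sub_self]
    _ ≤ _ := by
        refine integral_mono (hM.sub hMT) (hg.indicator hs) fun x => ?_
        by_cases hx : 0 < birkhoffMax T g n x
        · have := birkhoffMax_le_add_of_pos hx
          rw [Set.indicator_of_mem (by exact hx)]
          simp only
          linarith
        · rw [Set.indicator_of_notMem (by exact hx)]
          have := birkhoffMax_nonneg (T := T) (g := g) n (T x)
          simp only
          linarith

end BirkhoffMax

theorem bddAbove_range_birkhoffSum_comp_iff {α : Type*} {T : α → α} (g : α → ℝ) (x : α) :
    BddAbove (Set.range fun n => birkhoffSum T g n (T x)) ↔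
      BddAbove (Set.range fun n => birkhoffSum T g n x) := by
  constructor
  · rintro ⟨K, hK⟩
    refine ⟨max 0 (g x + K), ?_⟩
    rintro _ ⟨n, rfl⟩
    cases n with
    | zero => simp
    | succ n =>
      simp only [birkhoffSum_succ']
      exact (add_le_add le_rfl (hK ⟨n, rfl⟩)).trans (le_max_right _ _)
  · rintro ⟨K, hK⟩
    refine ⟨K - g x, ?_⟩
    rintro _ ⟨n, rfl⟩
    have := hK ⟨n + 1, rfl⟩
    simp only [birkhoffSum_succ'] at this ⊢
    linarith

section PointwiseErgodic

variable {α : Type*} [MeasurableSpace α] {μ : Measure α} {T : α → α}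

theorem ae_bddAbove_range_birkhoffSum (hT : Ergodic T μ) {g : α → ℝ}
    (hgm : Measurable g) (hg : Integrable g μ) (hneg : ∫ x, g x ∂μ < 0) :
    ∀ᵐ x ∂μ, BddAbove (Set.range fun n => birkhoffSum T g n x) := by
  have hSm : ∀ n, Measurable (birkhoffSum T g n) := fun n =>
    Finset.measurable_sum _ fun i _ => hgm.comp (hT.measurable.iterate i)
  have hE : MeasurableSet {x | BddAbove (Set.range fun n => birkhoffSum T g n x)} :=
    measurableSet_bddAbove_range hSm
  have hinv : T ⁻¹' {x | BddAbove (Set.range fun n => birkhoffSum T g n x)} =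
      {x | BddAbove (Set.range fun n => birkhoffSum T g n x)} :=
    Set.ext fun x => bddAbove_range_birkhoffSum_comp_iff g x
  rcases hT.ae_empty_or_univ hE hinv with h | h
  · exfalso
    have hpos : ∀ᵐ x ∂μ, x ∈ ⋃ n, {x | 0 < birkhoffMax T g n x} := by
      filter_upwards [h] with x hx
      have hx' : ¬ BddAbove (Set.range fun n => birkhoffSum T g n x) := fun hb => by
        have : (∅ : Set α) x := hx ▸ hb
        exact this
      rw [not_bddAbove_iff] at hx'
      obtain ⟨_, ⟨n, rfl⟩, hn⟩ := hx' 0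
      exact Set.mem_iUnion.2 ⟨n, hn.trans_le (birkhoffSum_le_birkhoffMax n x)⟩
    have hlim := tendsto_setIntegral_of_monotone (μ := μ) (f := g)
      (s := fun n => {x | 0 < birkhoffMax T g n x})
      (fun n => measurableSet_lt measurable_const (measurable_birkhoffMax hT.measurable hgm n))
      (fun m n hmn x hx => lt_of_lt_of_le hx (monotone_birkhoffMax x hmn)) hg.integrableOn
    rw [Measure.restrict_eq_self_of_ae_mem hpos] at hlim
    exact hneg.not_ge (ge_of_tendsto' hlim fun n =>
      setIntegral_birkhoffMax_pos_nonneg hT.toMeasurePreserving hgm hg n)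
  · exact eventuallyEq_univ.1 h

variable [IsProbabilityMeasure μ]

theorem ae_eventually_birkhoffAverage_lt (hT : Ergodic T μ) {f : α → ℝ}
    (hfm : Measurable f) (hf : Integrable f μ) {c : ℝ} (hc : ∫ x, f x ∂μ < c) :
    ∀ᵐ x ∂μ, ∀ᶠ n in atTop, birkhoffAverage ℝ T f n x < c := by
  obtain ⟨d, hd, hdc⟩ := exists_between hc
  have hneg : ∫ x, (f x - d) ∂μ < 0 := by
    rw [integral_sub hf (integrable_const d)]
    simpa using hd
  filter_upwards [ae_bddAbove_range_birkhoffSum hT (hfm.sub_const d)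
    (hf.sub (integrable_const d)) hneg] with x ⟨K, hK⟩
  have hlim : Tendsto (fun n : ℕ => K / n + d) atTop (nhds (0 + d)) :=
    (tendsto_const_div_atTop_nhds_zero_nat K).add_const d
  rw [zero_add] at hlim
  filter_upwards [hlim.eventually_lt_const hdc, eventually_gt_atTop 0] with n hn hn0
  refine lt_of_le_of_lt ?_ hn
  have hK' : birkhoffSum T f n x - n * d ≤ K := by
    have := hK ⟨n, rfl⟩
    simpa [birkhoffSum, Finset.sum_sub_distrib] using this
  have hn0' : (0 : ℝ) < n := by exact_mod_cast hn0
  rw [birkhoffAverage, smul_eq_mul, inv_mul_eq_div, div_add' _ _ _ hn0'.ne',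
    div_le_div_iff_of_pos_right hn0']
  linarith

/-- The pointwise ergodic theorem for an ergodic transformation of a probability space. -/
theorem ae_tendsto_birkhoffAverage (hT : Ergodic T μ) {f : α → ℝ}
    (hfm : Measurable f) (hf : Integrable f μ) :
    ∀ᵐ x ∂μ, Tendsto (fun n => birkhoffAverage ℝ T f n x) atTop (nhds (∫ x, f x ∂μ)) := by
  obtain ⟨u, -, hu, hlim⟩ := exists_seq_strictAnti_tendsto (0 : ℝ)
  have hup : ∀ᵐ x ∂μ, ∀ k, ∀ᶠ n in atTop,
      birkhoffAverage ℝ T f n x < ∫ x, f x ∂μ + u k :=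
    ae_all_iff.2 fun k => ae_eventually_birkhoffAverage_lt hT hfm hf (by linarith [hu k])
  have hdown : ∀ᵐ x ∂μ, ∀ k, ∀ᶠ n in atTop,
      birkhoffAverage ℝ T (-f) n x < -∫ x, f x ∂μ + u k :=
    ae_all_iff.2 fun k => ae_eventually_birkhoffAverage_lt hT hfm.neg hf.neg (by
      simp only [Pi.neg_apply, integral_neg]
      linarith [hu k])
  filter_upwards [hup, hdown] with x h₁ h₂
  refine tendsto_order.2 ⟨fun a ha => ?_, fun a ha => ?_⟩
  · obtain ⟨k, hk⟩ := (hlim.eventually_lt_const (sub_pos.2 ha)).exists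
    filter_upwards [h₂ k] with n hn
    simp only [birkhoffAverage_neg, Pi.neg_apply] at hn
    linarith
  · obtain ⟨k, hk⟩ := (hlim.eventually_lt_const (sub_pos.2 ha)).exists
    filter_upwards [h₁ k] with n hn
    linarith

end PointwiseErgodic

section Empirical

variable {A : Type*}

theorem shift_iterate_apply (i : ℕ) (ω : ℕ → A) (j : ℕ) : shift^[i] ω j = ω (i + j) := by
  induction i generalizing ω with
  | zero => simp
  | succ i ih =>
    rw [Function.iterate_succ_apply, ih]
    exact congrArg ω (by omega)

theorem length_pref (ω : ℕ → A) (n : ℕ) : (pref ω n).length = n := by simp [pref]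

theorem take_drop_pref (ω : ℕ → A) {i l n : ℕ} (h : i + l ≤ n) :
    ((pref ω n).drop i).take l = List.ofFn fun j : Fin l => ω (i + j) := by
  refine List.ext_getElem (by simp [pref]; omega) fun j _ _ => by simp [pref]

theorem measurableSet_cyl [MeasurableSpace A] [MeasurableSingletonClass A] {l : ℕ}
    (v : Fin l → A) : MeasurableSet (cyl v) := by
  have h : cyl v = ⋂ i : Fin l, (fun ω : ℕ → A => ω i) ⁻¹' {v i} := by
    ext ω
    simp [cyl]
  rw [h]
  exact MeasurableSet.iInter fun i =>
    measurable_pi_apply (i : ℕ) (measurableSet_singleton (v i))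

variable [DecidableEq A]

theorem empFreq_pref (ω : ℕ → A) {l n : ℕ} (h : l ≤ n) (v : Fin l → A) :
    empFreq (pref ω n) (List.ofFn v) =
      birkhoffAverage ℝ shift ((cyl v).indicator 1) (n - l + 1) ω := by
  classical
  simp only [empFreq, length_pref, List.length_ofFn, birkhoffAverage, birkhoffSum, smul_eq_mul,
    Finset.card_filter, Nat.cast_sum, div_eq_inv_mul]
  congr 1
  refine Finset.sum_congr rfl fun i hi => ?_
  rw [take_drop_pref ω (by have := Finset.mem_range.1 hi; omega), Set.indicator_apply]
  simp only [List.ofFn_inj, cyl, Set.mem_ofPred_eq, shift_iterate_apply, funext_iff]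
  split_ifs <;> simp

theorem empEnt_pref [Fintype A] (ω : ℕ → A) {l n : ℕ} (h : l ≤ n) :
    empEnt l (pref ω n) = -(1 / (l : ℝ)) * ∑ v : Fin l → A,
      empFreq (pref ω n) (List.ofFn v) * Real.logb 2 (empFreq (pref ω n) (List.ofFn v)) := by
  rw [empEnt, ← Finset.sum_image (s := Finset.univ) (g := List.ofFn)
    (f := fun w => empFreq (pref ω n) w * Real.logb 2 (empFreq (pref ω n) w))
    (fun v _ v' _ hv => List.ofFn_injective hv)]
  congr 1
  refine Finset.sum_subset (fun w hw => ?_) fun w hw hw' => ?_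
  · obtain ⟨i, hi, rfl⟩ := Finset.mem_image.1 hw
    rw [length_pref, Finset.mem_range] at hi
    rw [take_drop_pref ω (by omega)]
    exact Finset.mem_image_of_mem _ (Finset.mem_univ _)
  · obtain ⟨v, -, rfl⟩ := Finset.mem_image.1 hw
    have hzero : empFreq (pref ω n) (List.ofFn v) = 0 := by
      rw [empFreq, List.length_ofFn, Finset.filter_eq_empty_iff.2, Finset.card_empty,
        Nat.cast_zero, zero_div]
      exact fun i hi hv => hw' (Finset.mem_image.2 ⟨i, hi, hv⟩)
    rw [hzero, zero_mul]

variable [MeasurableSpace A] [MeasurableSingletonClass A] {μ : Measure (ℕ → A)}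
  [IsProbabilityMeasure μ]

theorem ae_tendsto_empFreq_pref (herg : Ergodic (shift (A := A)) μ) {l : ℕ} (v : Fin l → A) :
    ∀ᵐ ω ∂μ, Tendsto (fun n => empFreq (pref ω n) (List.ofFn v)) atTop
      (nhds (μ (cyl v)).toReal) := by
  have hm := measurableSet_cyl v
  filter_upwards [ae_tendsto_birkhoffAverage herg
    (f := (cyl v).indicator 1) (measurable_one.indicator hm)
    ((integrable_const (1 : ℝ)).indicator hm)] with ω hω
  rw [integral_indicator_one hm] at hω
  refine (hω.comp ((tendsto_add_atTop_nat 1).comp (tendsto_sub_atTop_nat l))).congr' ?_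
  filter_upwards [eventually_ge_atTop l] with n hn
  exact (empFreq_pref ω hn v).symm

theorem ae_tendsto_empEnt_pref [Fintype A] (herg : Ergodic (shift (A := A)) μ) (l : ℕ) :
    ∀ᵐ ω ∂μ, Tendsto (fun n => empEnt l (pref ω n)) atTop (nhds (entSeq μ l)) := by
  have hcont : Continuous fun x : ℝ => x * Real.logb 2 x := by
    simpa only [Real.logb, mul_div_assoc] using Real.continuous_mul_log.div_const (Real.log 2)
  filter_upwards [ae_all_iff.2 fun v : Fin l → A => ae_tendsto_empFreq_pref herg v] with ω hω
  have hent : entSeq μ l = -(1 / (l : ℝ)) * ∑ v : Fin l → A,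
      (μ (cyl v)).toReal * Real.logb 2 (μ (cyl v)).toReal := by
    rw [entSeq, Finset.sum_neg_distrib, mul_neg, neg_mul]
  rw [hent]
  refine ((tendsto_finsetSum Finset.univ fun v _ =>
    (hcont.tendsto _).comp (hω v)).const_mul (-(1 / (l : ℝ)))).congr' ?_
  filter_upwards [eventually_ge_atTop l] with n hn
  exact (empEnt_pref ω hn).symm

end Empirical

/-- If `μ` is an ergodic shift-invariant probability measure on `A^ℕ`, then for `μ`-almost
every `ω` the limit `Ĥ(ω) = lim_l limsup_n Ĥ_l(ωⁿ)` exists and equals the entropy `h(μ)`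
of the shift (given as the limit `hμ` of the entropy sequence). -/
theorem stmt_5 {A : Type} [Fintype A] [Nonempty A] [DecidableEq A]
    [MeasurableSpace A] [MeasurableSingletonClass A]
    (μ : Measure (ℕ → A)) [IsProbabilityMeasure μ]
    (herg : Ergodic (shift (A := A)) μ)
    (hμ : ℝ) (hent : Filter.Tendsto (entSeq μ) Filter.atTop (nhds hμ)) :
    ∀ᵐ ω ∂μ, Filter.Tendsto
      (fun l : ℕ => Filter.atTop.limsup fun n : ℕ => empEnt l (pref ω n))
      Filter.atTop (nhds hμ) := by
  filter_upwards [ae_all_iff.2 fun l => ae_tendsto_empEnt_pref herg l] with ω hω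
  simpa only [(hω _).limsup_eq] using hent
end
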